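/- Let \beta be a real number and let \lambda_1, \dots, \lambda_N be pairwise distinct real numbers satisfying the equilibrium equations \beta \lambda_k = \frac{2}{N} \sum_{l \neq k} \frac{1}{\lambda_k - \lambda_l} for all k. Then for every real x with x \neq \lambda_k for all k, the resolvent W(x) = \frac{1}{N}\sum_{k=1}^N \frac{1}{x - \lambda_k} satisfies the exact identity N^2 W(x)^2 - \sum_{k=1}^N \frac{1}{(x-\lambda_k)^2} = \beta N^2 \bigl(x\, W(x) - 1\bigr). -/

import Mathlib

/-- Partial fractions for the off-diagonal part of `(∑ k, (x - a k)⁻¹) ^ 2`; the diagonal terms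
`l = k` on the right vanish by the convention `0⁻¹ = 0`. -/
theorem sq_sum_inv_sub_sub_sum_inv_sq {ι K : Type*} [Field K] (s : Finset ι) {a : ι → K}
    (ha : Set.InjOn a s) {x : K} (hx : ∀ k ∈ s, x ≠ a k) :
    (∑ k ∈ s, (x - a k)⁻¹) ^ 2 - ∑ k ∈ s, ((x - a k) ^ 2)⁻¹ =
      2 * ∑ k ∈ s, (x - a k)⁻¹ * ∑ l ∈ s, (a k - a l)⁻¹ := by
  classical
  have h_pair : ∀ k ∈ s, ∀ l ∈ s, (x - a k)⁻¹ * (x - a l)⁻¹ =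
      (if k = l then ((x - a k) ^ 2)⁻¹ else 0) +
        ((x - a k)⁻¹ * (a k - a l)⁻¹ + (x - a l)⁻¹ * (a l - a k)⁻¹) := by
    intro k hk l hl
    split_ifs with hkl
    · subst hkl
      simp [sq]
    · have h1 := sub_ne_zero.2 (hx k hk)
      have h2 := sub_ne_zero.2 (hx l hl)
      have h3 : a k - a l ≠ 0 := sub_ne_zero.2 fun h => hkl (ha hk hl h)
      rw [← neg_sub (a k) (a l), inv_neg]
      field_simp
      ring
  have h_diag : ∑ k ∈ s, ∑ l ∈ s, (if k = l then ((x - a k) ^ 2)⁻¹ else 0) =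
      ∑ k ∈ s, ((x - a k) ^ 2)⁻¹ :=
    Finset.sum_congr rfl fun k hk => by simp [hk]
  rw [sq, Finset.sum_mul_sum,
    Finset.sum_congr rfl fun k hk => Finset.sum_congr rfl fun l hl => h_pair k hk l hl]
  simp only [Finset.sum_add_distrib, h_diag, Finset.mul_sum s _ (x - a _)⁻¹]
  rw [Finset.sum_comm (f := fun k l => (x - a l)⁻¹ * (a l - a k)⁻¹)]
  ring


/-- Exact finite-`N` resolvent identity: if the pairwise distinct reals `λ_1, …, λ_N` satisfy
the equilibrium equations `β λ_k = (2/N) ∑_{l ≠ k} 1/(λ_k - λ_l)`, then for every `x` distinct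
from all `λ_k`, the resolvent `W(x) = (1/N) ∑_k 1/(x - λ_k)` satisfies
`N² W(x)² - ∑_k 1/(x-λ_k)² = β N² (x W(x) - 1)`. -/
theorem resolvent_quadratic_identity (N : ℕ) (hN : 0 < N) (β : ℝ)
    (lam : Fin N → ℝ) (hinj : Function.Injective lam)
    (heq : ∀ k, β * lam k =
      (2 / N) * ∑ l ∈ Finset.univ.filter (fun l => l ≠ k), (lam k - lam l)⁻¹)
    (x : ℝ) (hx : ∀ k, x ≠ lam k)
    (W : ℝ) (hW : W = (1 / N) * ∑ k : Fin N, (x - lam k)⁻¹) :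
    (N : ℝ) ^ 2 * W ^ 2 - ∑ k : Fin N, ((x - lam k) ^ 2)⁻¹ =
      β * (N : ℝ) ^ 2 * (x * W - 1) := by
  have hN0 : (N : ℝ) ≠ 0 := by exact_mod_cast hN.ne'
  set S : ℝ := ∑ k : Fin N, (x - lam k)⁻¹ with hS
  have h_force (k : Fin N) : N * (β * lam k) = 2 * ∑ l, (lam k - lam l)⁻¹ := by
    rw [heq k, Finset.sum_filter_of_ne]
    · field_simp
    · rintro l - hl rfl
      simp at hl
  have h_sq := sq_sum_inv_sub_sub_sum_inv_sq Finset.univ hinj.injOn (fun k _ => hx k)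
  have h_lin : ∑ k, (x - lam k)⁻¹ * lam k = x * S - N := by
    have (k : Fin N) : (x - lam k)⁻¹ * lam k = x * (x - lam k)⁻¹ - 1 := by
      have := sub_ne_zero.2 (hx k)
      field_simp
      ring
    simp [this, Finset.sum_sub_distrib, ← Finset.mul_sum, hS]
  have h_rhs : 2 * ∑ k, (x - lam k)⁻¹ * ∑ l, (lam k - lam l)⁻¹ = N * β * (x * S - N) := by
    rw [← h_lin, Finset.mul_sum, Finset.mul_sum]
    refine Finset.sum_congr rfl fun k _ => ?_
    linear_combination -(x - lam k)⁻¹ * h_force k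
  have hNW : N * W = S := by
    rw [hW]
    field_simp
  rw [← mul_pow, hNW, h_sq, h_rhs, ← hNW]
  ring
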